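/- arXiv:math/0703843 — 8 statements merged into one kernel-verified Lean document; each statement's English description precedes it below -/
import Mathlib

section
/- Let ℓ ≥ 1 and let 1 ≤ i ≤ j ≤ ℓ. If λ ∈ ℤ^{ℓ+1} has weakly decreasing coordinates and ε_i + ε_j − λ lies in the additive submonoid of ℤ^{ℓ+1} generated by α_1, …, α_ℓ, then there exist indices 0 ≤ a ≤ b ≤ ℓ+1 such that λ = ε_a + ε_b. (In other words, every dominant weight below the sum of two fundamental weights of A_ℓ in the dominant order is a sum of at most two fundamental weights: the weight lattice of type A_ℓ is quadratic.) -/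
/-- A downward closed predicate on `Fin n` holds exactly on an initial segment. -/
theorem Fin.exists_forall_val_lt_iff {n : ℕ} (P : Fin n → Prop)
    (hP : ∀ p q : Fin n, p ≤ q → P q → P p) :
    ∃ a ≤ n, ∀ m : Fin n, (m : ℕ) < a ↔ P m := by
  classical
  have hex : ∃ a, ∀ m : Fin n, P m → (m : ℕ) < a := ⟨n, fun m _ => m.isLt⟩
  refine ⟨Nat.find hex, Nat.find_min' hex fun m _ => m.isLt,
    fun m => ⟨fun hm => ?_, Nat.find_spec hex m⟩⟩
  have hmin := Nat.find_min hex hm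
  push Not at hmin
  obtain ⟨q, hq, hmq⟩ := hmin
  exact hP m q hmq hq

/-- A nonnegative combination of simple roots of type `A_ℓ` has nonnegative first coordinate and
nonpositive last coordinate. -/
theorem zero_le_first_and_last_le_zero_of_mem_closure_simpleRoots {ℓ : ℕ} {v : Fin (ℓ + 1) → ℤ}
    (hv : v ∈ AddSubmonoid.closure (Set.range fun k : Fin ℓ => fun m : Fin (ℓ + 1) =>
      if (m : ℕ) = (k : ℕ) then (1 : ℤ) else if (m : ℕ) = (k : ℕ) + 1 then -1 else 0)) :
    0 ≤ v 0 ∧ v (Fin.last ℓ) ≤ 0 := by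
  induction hv using AddSubmonoid.closure_induction with
  | mem x hx =>
    obtain ⟨k, rfl⟩ := hx
    have hk := k.isLt
    simp only [Fin.val_zero, Fin.val_last]
    constructor <;> split_ifs <;> simp <;> omega
  | zero => simp
  | add x y _ _ hx hy =>
    simp only [Pi.add_apply]
    omega

/-- **The weight lattice of type `A_ℓ` is quadratic** (the type `A` case of
Proposition 5 of Chirivì–Littelmann–Maffei).

Work in `ℤ^{ℓ+1}` with standard basis `e₁, …, e_{ℓ+1}` (coordinates `m : Fin (ℓ+1)`
are `0`-indexed).  The simple roots of type `A_ℓ` are `α_k = e_k - e_{k+1}` for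
`1 ≤ k ≤ ℓ`, and `ε_i = e₁ + … + e_i` for `0 ≤ i ≤ ℓ+1` (so `ε_0 = 0`, the `ε_i` with
`1 ≤ i ≤ ℓ` are the fundamental weights, and `ε_{ℓ+1} = (1,…,1)` represents the zero
weight).  If `λ` has weakly decreasing coordinates (i.e. is dominant) and
`ε_i + ε_j - λ` lies in the additive submonoid generated by `α₁, …, α_ℓ` for some
`1 ≤ i ≤ j ≤ ℓ`, then `λ = ε_a + ε_b` for some `0 ≤ a ≤ b ≤ ℓ+1`. -/
theorem typeA_weight_lattice_quadratic (ℓ : ℕ) (hℓ : 1 ≤ ℓ)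
    (i j : ℕ) (hi : 1 ≤ i) (hij : i ≤ j) (hj : j ≤ ℓ)
    (lam : Fin (ℓ + 1) → ℤ)
    (hdom : ∀ p q : Fin (ℓ + 1), p ≤ q → lam q ≤ lam p)
    (hle : (fun m : Fin (ℓ + 1) =>
        (if (m : ℕ) < i then (1 : ℤ) else 0) + (if (m : ℕ) < j then 1 else 0) - lam m)
      ∈ AddSubmonoid.closure (Set.range fun k : Fin ℓ => fun m : Fin (ℓ + 1) =>
          if (m : ℕ) = (k : ℕ) then (1 : ℤ)
          else if (m : ℕ) = (k : ℕ) + 1 then -1 else 0)) :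
    ∃ a b : ℕ, a ≤ b ∧ b ≤ ℓ + 1 ∧
      lam = fun m : Fin (ℓ + 1) =>
        (if (m : ℕ) < a then (1 : ℤ) else 0) + (if (m : ℕ) < b then 1 else 0) := by
  obtain ⟨h0, hlast⟩ := zero_le_first_and_last_le_zero_of_mem_closure_simpleRoots hle
  have upper : ∀ m, lam m ≤ 2 := fun m => by
    have := hdom 0 m (Fin.zero_le m)
    split_ifs at h0 <;> omega
  have lower : ∀ m, 0 ≤ lam m := fun m => by
    have := hdom m (Fin.last ℓ) (Fin.le_last m)
    simp only [Fin.val_last] at hlast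
    split_ifs at hlast <;> omega
  obtain ⟨a, ha, ha'⟩ := Fin.exists_forall_val_lt_iff (fun m => 2 ≤ lam m)
    fun p q hpq hq => hq.trans (hdom p q hpq)
  obtain ⟨b, hb, hb'⟩ := Fin.exists_forall_val_lt_iff (fun m => 1 ≤ lam m)
    fun p q hpq hq => hq.trans (hdom p q hpq)
  refine ⟨a, b, ?_, hb, ?_⟩
  · by_contra! hba
    have h2 := (ha' ⟨b, by omega⟩).1 hba
    exact lt_irrefl b ((hb' ⟨b, by omega⟩).2 (by omega))
  · funext m
    have h1 := upper m
    have h2 := lower m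
    simp only [ha', hb']
    split_ifs <;> omega
end

section
/- Let ℓ ≥ 1 and let 1 ≤ i ≤ j ≤ ℓ. If λ ∈ ℤ^ℓ is dominant (λ_1 ≥ … ≥ λ_ℓ ≥ 0) and ε_i + ε_j − λ lies in the additive submonoid of ℤ^ℓ generated by α_1, …, α_ℓ (type C_ℓ simple roots), then there exist indices 0 ≤ a ≤ b ≤ ℓ such that λ = ε_a + ε_b. (The weight lattice of type C_ℓ is quadratic.) -/
/-- A downward closed predicate on `Fin n` holds exactly below some threshold `b ≤ n`. -/
lemma exists_forall_fin_lt_iff_of_antitone {n : ℕ} {P : Fin n → Prop}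
    (hP : ∀ p q : Fin n, p ≤ q → P q → P p) :
    ∃ b ≤ n, ∀ m : Fin n, (m : ℕ) < b ↔ P m := by
  classical
  have hex : ∃ b, ∀ m : Fin n, b ≤ (m : ℕ) → ¬ P m := ⟨n, fun m hm => absurd m.isLt (by omega)⟩
  refine ⟨Nat.find hex, Nat.find_min' hex fun m hm => absurd m.isLt (by omega),
    fun m => ⟨fun hm => ?_, fun hm => ?_⟩⟩
  · have h := Nat.find_min hex hm
    push Not at h
    obtain ⟨q, hmq, hq⟩ := h
    exact hP m q hmq hq
  · by_contra! h
    exact Nat.find_spec hex m h hm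

/-- **The weight lattice of type `C_ℓ` is quadratic** (the type `C` case of
Proposition 5 of Chirivì–Littelmann–Maffei).

Work in `ℤ^ℓ` with standard basis `e₁, …, e_ℓ` (coordinates `m : Fin ℓ` are
`0`-indexed).  The simple roots of type `C_ℓ` are `α_k = e_k - e_{k+1}` for
`1 ≤ k ≤ ℓ-1` and `α_ℓ = 2e_ℓ`; set `ε_0 = 0` and `ε_i = e₁ + … + e_i` for
`1 ≤ i ≤ ℓ` (the fundamental weights).  If `λ` is dominant (`λ₁ ≥ … ≥ λ_ℓ ≥ 0`) and
`ε_i + ε_j - λ` lies in the additive submonoid generated by `α₁, …, α_ℓ` for some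
`1 ≤ i ≤ j ≤ ℓ`, then `λ = ε_a + ε_b` for some `0 ≤ a ≤ b ≤ ℓ`. -/
theorem typeC_weight_lattice_quadratic (ℓ : ℕ) (hℓ : 1 ≤ ℓ)
    (i j : ℕ) (hi : 1 ≤ i) (hij : i ≤ j) (hj : j ≤ ℓ)
    (lam : Fin ℓ → ℤ)
    (hdec : ∀ p q : Fin ℓ, p ≤ q → lam q ≤ lam p)
    (hpos : ∀ m, 0 ≤ lam m)
    (hle : (fun m : Fin ℓ =>
        (if (m : ℕ) < i then (1 : ℤ) else 0) + (if (m : ℕ) < j then 1 else 0) - lam m)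
      ∈ AddSubmonoid.closure (Set.range fun k : Fin ℓ => fun m : Fin ℓ =>
          if (k : ℕ) + 1 = ℓ then (if m = k then (2 : ℤ) else 0)
          else if m = k then 1 else if (m : ℕ) = (k : ℕ) + 1 then -1 else 0)) :
    ∃ a b : ℕ, a ≤ b ∧ b ≤ ℓ ∧
      lam = fun m : Fin ℓ =>
        (if (m : ℕ) < a then (1 : ℤ) else 0) + (if (m : ℕ) < b then 1 else 0) := by
  have h0 := AddSubmonoid.closure_le (S := (AddSubmonoid.nonneg ℤ).comap
      (Pi.evalAddMonoidHom (fun _ : Fin ℓ => ℤ) ⟨0, hℓ⟩)) |>.2 (by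
    rintro _ ⟨k, rfl⟩
    simp only [SetLike.mem_coe, AddSubmonoid.mem_comap, Pi.evalAddMonoidHom_apply,
      AddSubmonoid.mem_nonneg]
    split_ifs <;> simp_all) hle
  simp only [AddSubmonoid.mem_comap, Pi.evalAddMonoidHom_apply, AddSubmonoid.mem_nonneg] at h0
  have hle_two (m : Fin ℓ) : lam m ≤ 2 := by
    have h1 := hdec ⟨0, hℓ⟩ m (Nat.zero_le _)
    split_ifs at h0 <;> omega
  obtain ⟨a, ha, ha'⟩ := exists_forall_fin_lt_iff_of_antitone (P := fun m => 2 ≤ lam m)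
    fun p q hpq hq => hq.trans (hdec p q hpq)
  obtain ⟨b, hb, hb'⟩ := exists_forall_fin_lt_iff_of_antitone (P := fun m => 1 ≤ lam m)
    fun p q hpq hq => hq.trans (hdec p q hpq)
  refine ⟨a, b, ?_, hb, ?_⟩
  · by_contra! hba
    have h2 := (ha' ⟨b, by omega⟩).1 hba
    exact lt_irrefl b ((hb' ⟨b, by omega⟩).2 (by omega))
  · funext m
    have h1 := ha' m
    have h2 := hb' m
    have h3 := hpos m
    have h4 := hle_two m
    split_ifs <;> omega
end

section
/- Let ℓ ≥ 1 and let 1 ≤ i ≤ j ≤ ℓ. If λ ∈ ℤ^ℓ is dominant (λ_1 ≥ … ≥ λ_ℓ ≥ 0) and ε_i + ε_j − λ lies in the additive submonoid of ℤ^ℓ generated by α_1, …, α_ℓ (type B_ℓ simple roots), then there exist indices 0 ≤ a ≤ b ≤ ℓ such that λ = ε_a + ε_b. (The root lattice of type B_ℓ, equivalently the weight lattice of type BC_ℓ with the paper's Convention 4, is quadratic.) -/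
/-- Every superlevel set of an antitone function on `Fin n` is an initial segment. -/
theorem exists_lt_iff_le_of_antitone {n : ℕ} {f : Fin n → ℤ} (hf : Antitone f) (c : ℤ) :
    ∃ a ≤ n, ∀ m : Fin n, (m : ℕ) < a ↔ c ≤ f m := by
  classical
  have hex : ∃ k : ℕ, ∀ m : Fin n, k ≤ m → f m < c :=
    ⟨n, fun m hm => absurd m.isLt (not_lt.mpr hm)⟩
  refine ⟨Nat.find hex, Nat.find_min' hex fun m hm => absurd m.isLt (not_lt.mpr hm), ?_⟩
  intro m
  constructor
  · intro hm
    have hmin := Nat.find_min hex hm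
    push Not at hmin
    obtain ⟨q, hmq, hq⟩ := hmin
    exact hq.trans (hf hmq)
  · intro hm
    by_contra! h
    exact absurd hm (not_le.mpr (Nat.find_spec hex m h))

/-- The submonoid generated by functions that are nonnegative at a point consists of functions
that are nonnegative there. -/
theorem apply_nonneg_of_mem_closure {ι : Type*} {S : Set (ι → ℤ)} {m : ι}
    (hS : ∀ v ∈ S, 0 ≤ v m) {v : ι → ℤ} (hv : v ∈ AddSubmonoid.closure S) : 0 ≤ v m := by
  induction hv using AddSubmonoid.closure_induction with
  | mem x hx => exact hS x hx
  | zero => exact le_rfl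
  | add x y _ _ hx hy => exact add_nonneg hx hy

/-- An antitone function on `Fin n` with values in `{0, 1, 2}` is a sum of the indicator functions
of two initial segments. -/
theorem exists_eq_add_of_antitone_of_le_two {n : ℕ} {f : Fin n → ℤ} (hf : Antitone f)
    (hf0 : ∀ m, 0 ≤ f m) (hf2 : ∀ m, f m ≤ 2) :
    ∃ a b : ℕ, a ≤ b ∧ b ≤ n ∧
      f = fun m : Fin n =>
        (if (m : ℕ) < a then (1 : ℤ) else 0) + (if (m : ℕ) < b then 1 else 0) := by
  obtain ⟨a, han, ha⟩ := exists_lt_iff_le_of_antitone hf 2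
  obtain ⟨b, hbn, hb⟩ := exists_lt_iff_le_of_antitone hf 1
  refine ⟨a, b, ?_, hbn, ?_⟩
  · by_contra! hba
    have h2 := (ha ⟨b, hba.trans_le han⟩).1 hba
    exact lt_irrefl b ((hb ⟨b, hba.trans_le han⟩).2 (by omega))
  · funext m
    have h0 := hf0 m
    have h2 := hf2 m
    simp only [ha m, hb m]
    split_ifs <;> omega

/-- **The root lattice of type `B_ℓ` is quadratic** (the type `B`/`BC` case of
Proposition 5 of Chirivì–Littelmann–Maffei); equivalently, the weight lattice of type
`BC_ℓ` with the paper's Convention 4 is quadratic.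

Work in `ℤ^ℓ` with standard basis `e₁, …, e_ℓ` (coordinates `m : Fin ℓ` are
`0`-indexed).  The simple roots of type `B_ℓ` are `α_k = e_k - e_{k+1}` for
`1 ≤ k ≤ ℓ-1` and `α_ℓ = e_ℓ`; set `ε_0 = 0` and `ε_i = e₁ + … + e_i` for
`1 ≤ i ≤ ℓ` (the quadratic basis).  If `λ` is dominant (`λ₁ ≥ … ≥ λ_ℓ ≥ 0`) and
`ε_i + ε_j - λ` lies in the additive submonoid generated by `α₁, …, α_ℓ` for some
`1 ≤ i ≤ j ≤ ℓ`, then `λ = ε_a + ε_b` for some `0 ≤ a ≤ b ≤ ℓ`. -/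
theorem typeB_root_lattice_quadratic (ℓ : ℕ) (hℓ : 1 ≤ ℓ)
    (i j : ℕ) (hi : 1 ≤ i) (hij : i ≤ j) (hj : j ≤ ℓ)
    (lam : Fin ℓ → ℤ)
    (hdec : ∀ p q : Fin ℓ, p ≤ q → lam q ≤ lam p)
    (hpos : ∀ m, 0 ≤ lam m)
    (hle : (fun m : Fin ℓ =>
        (if (m : ℕ) < i then (1 : ℤ) else 0) + (if (m : ℕ) < j then 1 else 0) - lam m)
      ∈ AddSubmonoid.closure (Set.range fun k : Fin ℓ => fun m : Fin ℓ =>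
          if (k : ℕ) + 1 = ℓ then (if m = k then (1 : ℤ) else 0)
          else if m = k then 1 else if (m : ℕ) = (k : ℕ) + 1 then -1 else 0)) :
    ∃ a b : ℕ, a ≤ b ∧ b ≤ ℓ ∧
      lam = fun m : Fin ℓ =>
        (if (m : ℕ) < a then (1 : ℤ) else 0) + (if (m : ℕ) < b then 1 else 0) := by
  have h0 := apply_nonneg_of_mem_closure (m := (⟨0, hℓ⟩ : Fin ℓ)) (by
    rintro _ ⟨k, rfl⟩
    dsimp only
    split_ifs <;> first | omega | contradiction) hle
  refine exists_eq_add_of_antitone_of_le_two (fun p q => hdec p q) hpos fun m => ?_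
  refine (hdec ⟨0, hℓ⟩ m (Nat.zero_le (m : ℕ))).trans ?_
  dsimp only at h0
  split_ifs at h0 <;> omega
end

section
/- Let ℓ ≥ 3. In the weight lattice P of type B_ℓ, the weight λ = ω_{ℓ−2} + 2ω_ℓ (with ω_0 interpreted as 0 when ℓ = 3... here ℓ−2 ≥ 1, so λ = ω_{ℓ−2} + 2ω_ℓ with coordinates (2, …, 2, 1, 1), having ℓ−2 twos) satisfies: (a) λ is dominant; (b) 2ω_{ℓ−1} − λ = α_{ℓ−1}, hence λ ≤ ω_{ℓ−1} + ω_{ℓ−1} in the dominant order; (c) λ is not equal to 0, nor to ω_a, nor to ω_a + ω_b for any 1 ≤ a ≤ b ≤ ℓ. Consequently the full weight lattice of type B_ℓ, ℓ ≥ 3, is not quadratic. -/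
/-- **The full weight lattice of type `B_ℓ`, `ℓ ≥ 3`, is not quadratic** (part of the
proof of Proposition 5 of Chirivì–Littelmann–Maffei).

Work in `ℚ^ℓ` with standard basis `e₁, …, e_ℓ`.  The simple roots of type `B_ℓ` are
`α_k = e_k - e_{k+1}` for `1 ≤ k ≤ ℓ-1` and `α_ℓ = e_ℓ`; the fundamental weights are
`ω_i = e₁ + … + e_i` for `i ≤ ℓ-1` and `ω_ℓ = (e₁ + … + e_ℓ)/2`.  (Everything is
written with `0`-indexed coordinates `m : Fin ℓ`, while the labels `i` of `ω_i` and the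
labels of `α_k` stay `1`-indexed, so `α_k` has `0`-indexed label `k-1`.)

The weight `λ = ω_{ℓ-2} + 2ω_ℓ`, with coordinates `(2,…,2,1,1)` (having `ℓ-2` twos),
satisfies: (a) it is dominant; (b) `2ω_{ℓ-1} - λ = α_{ℓ-1}`, hence
`λ ≤ ω_{ℓ-1} + ω_{ℓ-1}` in the dominant order; (c) it is neither `0`, nor `ω_a`, nor
`ω_a + ω_b` for any `1 ≤ a ≤ b ≤ ℓ`. -/
theorem Bl_full_weight_lattice_not_quadratic (ℓ : ℕ) (hℓ : 3 ≤ ℓ) :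
    let ω : ℕ → (Fin ℓ → ℚ) := fun i m =>
      if i = ℓ then 1/2 else if (m : ℕ) < i then 1 else 0
    let α : Fin ℓ → (Fin ℓ → ℚ) := fun k m =>
      if (k : ℕ) + 1 = ℓ then (if m = k then 1 else 0)
      else if m = k then 1 else if (m : ℕ) = (k : ℕ) + 1 then -1 else 0
    let lam : Fin ℓ → ℚ := ω (ℓ - 2) + 2 • ω ℓ
    -- λ has coordinates (2, …, 2, 1, 1) with ℓ - 2 twos
    (∀ m : Fin ℓ, lam m = if (m : ℕ) < ℓ - 2 then 2 else 1) ∧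
    -- (a) λ is dominant
    ((∀ p q : Fin ℓ, p ≤ q → lam q ≤ lam p) ∧ ∀ m, 0 ≤ lam m) ∧
    -- (b) 2ω_{ℓ-1} - λ = α_{ℓ-1}, hence λ ≤ ω_{ℓ-1} + ω_{ℓ-1} in the dominant order
    ((2 • ω (ℓ - 1) - lam = α ⟨ℓ - 2, by omega⟩) ∧
      ω (ℓ - 1) + ω (ℓ - 1) - lam ∈ AddSubmonoid.closure (Set.range α)) ∧
    -- (c) λ is not a sum of at most two fundamental weights
    (lam ≠ 0 ∧ (∀ a, 1 ≤ a → a ≤ ℓ → lam ≠ ω a) ∧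
      ∀ a b, 1 ≤ a → a ≤ b → b ≤ ℓ → lam ≠ ω a + ω b) := by
  intro ω α lam
  have hlam (m : Fin ℓ) : lam m = if (m : ℕ) < ℓ - 2 then 2 else 1 := by
    have h : ℓ - 2 ≠ ℓ := by omega
    simp only [lam, ω, Pi.add_apply, Pi.smul_apply, h, if_true, if_false]
    split_ifs <;> norm_num
  have hroot : 2 • ω (ℓ - 1) - lam = α ⟨ℓ - 2, by omega⟩ := by
    funext m
    have h₁ : ℓ - 1 ≠ ℓ := by omega
    have h₂ : ℓ - 2 + 1 ≠ ℓ := by omega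
    have hm := m.isLt
    simp only [Pi.sub_apply, Pi.smul_apply, hlam, ω, α, h₁, h₂, if_false, Fin.ext_iff]
    split_ifs <;> first | omega | norm_num
  have hfirst : lam ⟨0, by omega⟩ = 2 := by
    rw [hlam, if_pos (by simp only; omega)]
  have hlast : lam ⟨ℓ - 1, by omega⟩ = 1 := by
    rw [hlam, if_neg (by simp only; omega)]
  have hω_last (a : ℕ) (ha : a ≤ ℓ) : ω a ⟨ℓ - 1, by omega⟩ = if a = ℓ then 1 / 2 else 0 := by
    simp only [ω]
    split_ifs <;> first | omega | rfl
  refine ⟨hlam, ⟨fun p q hpq => ?_, fun m => ?_⟩, ⟨hroot, ?_⟩, fun h => ?_, fun a _ ha h => ?_,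
    fun a b _ hab hb h => ?_⟩
  · have hpq' : (p : ℕ) ≤ q := hpq
    rw [hlam, hlam]
    split_ifs <;> first | omega | norm_num
  · rw [hlam]
    split_ifs <;> norm_num
  · rw [← two_nsmul, hroot]
    exact AddSubmonoid.subset_closure (Set.mem_range_self _)
  · simp [h] at hlast
  · rw [h, hω_last a ha] at hlast
    split_ifs at hlast <;> norm_num at hlast
  · rw [h, Pi.add_apply, hω_last a (hab.trans hb), hω_last b hb] at hlast
    split_ifs at hlast with h₁ h₂ <;> norm_num at hlast
    rw [h, h₁, h₂] at hfirst
    norm_num [ω] at hfirst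
end

section
/- Let ℓ ≥ 4. In the weight lattice P of type D_ℓ, the weight λ = ω_{ℓ−3} + ω_{ℓ−1} + ω_ℓ (with coordinates (2, …, 2, 1, 1, 0), having ℓ−3 twos) satisfies: (a) λ is dominant; (b) 2ω_{ℓ−2} − λ = α_{ℓ−2}, hence λ ≤ ω_{ℓ−2} + ω_{ℓ−2} in the dominant order; (c) λ is not equal to 0, nor to ω_a, nor to ω_a + ω_b for any 1 ≤ a ≤ b ≤ ℓ. Consequently the weight lattice of type D_ℓ, ℓ ≥ 4, is not quadratic. -/
/-- **The weight lattice of type `D_ℓ`, `ℓ ≥ 4`, is not quadratic** (part of the proof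
of Proposition 5 of Chirivì–Littelmann–Maffei).

Work in `ℚ^ℓ` with standard basis `e₁, …, e_ℓ`.  The simple roots of type `D_ℓ` are
`α_k = e_k - e_{k+1}` for `1 ≤ k ≤ ℓ-1` and `α_ℓ = e_{ℓ-1} + e_ℓ`; the fundamental
weights are `ω_i = e₁ + … + e_i` for `i ≤ ℓ-2`, `ω_{ℓ-1} = (e₁ + … + e_{ℓ-1} - e_ℓ)/2`
and `ω_ℓ = (e₁ + … + e_ℓ)/2`.  (Coordinates `m : Fin ℓ` are `0`-indexed, the labels of
the `ω_i` and `α_k` are `1`-indexed, so `α_k` has `0`-indexed label `k-1`.)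

The weight `λ = ω_{ℓ-3} + ω_{ℓ-1} + ω_ℓ`, with coordinates `(2,…,2,1,1,0)` (having
`ℓ-3` twos), satisfies: (a) it is dominant; (b) `2ω_{ℓ-2} - λ = α_{ℓ-2}`, hence
`λ ≤ ω_{ℓ-2} + ω_{ℓ-2}` in the dominant order; (c) it is neither `0`, nor `ω_a`, nor
`ω_a + ω_b` for any `1 ≤ a ≤ b ≤ ℓ`. -/
theorem Dl_weight_lattice_not_quadratic (ℓ : ℕ) (hℓ : 4 ≤ ℓ) :
    let ω : ℕ → (Fin ℓ → ℚ) := fun i m =>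
      if i = ℓ - 1 then (if (m : ℕ) = ℓ - 1 then -(1/2) else 1/2)
      else if i = ℓ then 1/2
      else if (m : ℕ) < i then 1 else 0
    let α : Fin ℓ → (Fin ℓ → ℚ) := fun k m =>
      if (k : ℕ) + 1 = ℓ then (if (m : ℕ) = ℓ - 2 ∨ (m : ℕ) = ℓ - 1 then 1 else 0)
      else if m = k then 1 else if (m : ℕ) = (k : ℕ) + 1 then -1 else 0
    let lam : Fin ℓ → ℚ := ω (ℓ - 3) + ω (ℓ - 1) + ω ℓ
    -- λ has coordinates (2, …, 2, 1, 1, 0) with ℓ - 3 twos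
    (∀ m : Fin ℓ, lam m =
      if (m : ℕ) < ℓ - 3 then 2 else if (m : ℕ) < ℓ - 1 then 1 else 0) ∧
    -- (a) λ is dominant (for type D: weakly decreasing and λ_{ℓ-1} + λ_ℓ ≥ 0)
    ((∀ p q : Fin ℓ, p ≤ q → lam q ≤ lam p) ∧
      0 ≤ lam ⟨ℓ - 2, by omega⟩ + lam ⟨ℓ - 1, by omega⟩) ∧
    -- (b) 2ω_{ℓ-2} - λ = α_{ℓ-2}, hence λ ≤ ω_{ℓ-2} + ω_{ℓ-2} in the dominant order
    ((2 • ω (ℓ - 2) - lam = α ⟨ℓ - 3, by omega⟩) ∧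
      ω (ℓ - 2) + ω (ℓ - 2) - lam ∈ AddSubmonoid.closure (Set.range α)) ∧
    -- (c) λ is not a sum of at most two fundamental weights
    (lam ≠ 0 ∧ (∀ a, 1 ≤ a → a ≤ ℓ → lam ≠ ω a) ∧
      ∀ a b, 1 ≤ a → a ≤ b → b ≤ ℓ → lam ≠ ω a + ω b) := by
  intro ω α lam
  have hlam : ∀ m : Fin ℓ, lam m =
      if (m : ℕ) < ℓ - 3 then 2 else if (m : ℕ) < ℓ - 1 then 1 else 0 := by
    intro m
    have hm := m.isLt
    simp only [lam, ω, Pi.add_apply]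
    split_ifs <;> first | omega | norm_num
  have hroot : 2 • ω (ℓ - 2) - lam = α ⟨ℓ - 3, by omega⟩ := by
    ext m
    have hm := m.isLt
    rw [Pi.sub_apply, Pi.smul_apply, hlam]
    simp only [ω, α, Fin.ext_iff]
    split_ifs <;> first | omega | norm_num
  have hle_one : ∀ a m, ω a m ≤ 1 := by
    intro a m
    simp only [ω]
    split_ifs <;> norm_num
  have hzero_of_one : ∀ a, a ≤ ℓ → ω a ⟨ℓ - 4, by omega⟩ = 1 → ω a ⟨ℓ - 2, by omega⟩ = 0 := by
    intro a ha
    simp only [ω]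
    split_ifs <;> first | omega | norm_num
  have htwo : lam ⟨ℓ - 4, by omega⟩ = 2 := by
    rw [hlam, if_pos (show ℓ - 4 < ℓ - 3 by omega)]
  have hone : lam ⟨ℓ - 2, by omega⟩ = 1 := by
    rw [hlam, if_neg (show ¬ ℓ - 2 < ℓ - 3 by omega), if_pos (show ℓ - 2 < ℓ - 1 by omega)]
  refine ⟨hlam, ⟨?_, ?_⟩, ⟨hroot, ?_⟩, ?_, ?_, ?_⟩
  · intro p q hpq
    have hpq' : (p : ℕ) ≤ q := hpq
    rw [hlam, hlam]
    split_ifs <;> first | omega | norm_num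
  · rw [hlam, hlam]
    split_ifs <;> norm_num
  · rw [← two_nsmul, hroot]
    exact AddSubmonoid.subset_closure (Set.mem_range_self _)
  · intro h
    rw [h] at htwo
    norm_num at htwo
  · intro a _ _ h
    rw [h] at htwo
    linarith [hle_one a ⟨ℓ - 4, by omega⟩]
  · intro a b _ hab hb h
    rw [h, Pi.add_apply] at htwo hone
    have ha' := hle_one a ⟨ℓ - 4, by omega⟩
    have hb' := hle_one b ⟨ℓ - 4, by omega⟩
    rw [hzero_of_one a (hab.trans hb) (by linarith), hzero_of_one b hb (by linarith)] at hone
    norm_num at hone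
end

section
/- Let ℓ ≥ 1 and 1 ≤ i ≤ ℓ (type B_ℓ setup). Then: (i) ε_1 + ε_{i−1} − ε_i = α_1 + α_2 + … + α_{i−1}, so ε_i ≤ ε_1 + ε_{i−1} in the dominant order; (ii) if λ, μ ∈ ℤ^ℓ are dominant and satisfy μ ≤ ε_1, λ ≤ ε_{i−1} and ε_i ≤ λ + μ, then μ = ε_1 and λ = ε_{i−1}. -/
/-- The `a`-th element `e₁ + ⋯ + e_a` of the quadratic basis of `ℤ^ℓ`. -/
def quadBasis (ℓ a : ℕ) : Fin ℓ → ℤ := fun m => if (m : ℕ) < a then 1 else 0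

/-- The simple roots of type `B_ℓ`. -/
def simpleRootB (ℓ : ℕ) (k : Fin ℓ) : Fin ℓ → ℤ := fun m =>
  if (k : ℕ) + 1 = ℓ then (if m = k then 1 else 0)
  else if m = k then 1 else if (m : ℕ) = (k : ℕ) + 1 then -1 else 0

theorem AddMonoidHom.nonneg_of_mem_closure_range {ι M : Type*} [AddMonoid M] {α : ι → M}
    (f : M →+ ℤ) (h : ∀ k, 0 ≤ f (α k)) {v : M}
    (hv : v ∈ AddSubmonoid.closure (Set.range α)) : 0 ≤ f v := by
  induction hv using AddSubmonoid.closure_induction with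
  | mem x hx => obtain ⟨k, rfl⟩ := hx; exact h k
  | zero => simp
  | add x y _ _ hx hy => rw [map_add]; exact add_nonneg hx hy

theorem sum_quadBasis {ℓ a : ℕ} (ha : a ≤ ℓ) : ∑ m, quadBasis ℓ a m = a := by
  simp only [quadBasis]
  rw [Fin.sum_univ_eq_sum_range (fun m => if m < a then (1 : ℤ) else 0), ← Finset.sum_filter]
  have : (Finset.range ℓ).filter (· < a) = Finset.range a := by
    ext; simp; omega
  simp [this]

theorem sum_simpleRootB_nonneg (ℓ : ℕ) (k : Fin ℓ) : 0 ≤ ∑ m, simpleRootB ℓ k m := by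
  by_cases hk : (k : ℕ) + 1 = ℓ
  · simp [simpleRootB, hk]
  · have h : ∀ m, simpleRootB ℓ k m =
        (if m = k then 1 else 0) - if m = ⟨k + 1, by omega⟩ then 1 else 0 := by
      intro m
      simp only [simpleRootB, Fin.ext_iff]
      grind
    simp [h]

theorem simpleRootB_zero_nonneg {ℓ : ℕ} (hℓ : 0 < ℓ) (k : Fin ℓ) :
    0 ≤ simpleRootB ℓ k ⟨0, hℓ⟩ := by
  simp only [simpleRootB]
  grind

theorem sum_nonneg_of_mem_closure_simpleRootB {ℓ : ℕ} {v : Fin ℓ → ℤ}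
    (hv : v ∈ AddSubmonoid.closure (Set.range (simpleRootB ℓ))) : 0 ≤ ∑ m, v m := by
  have h := AddMonoidHom.nonneg_of_mem_closure_range
    (∑ m, Pi.evalAddMonoidHom (fun _ : Fin ℓ => ℤ) m)
    (fun k => by simpa using sum_simpleRootB_nonneg ℓ k) hv
  simpa using h

theorem zero_nonneg_of_mem_closure_simpleRootB {ℓ : ℕ} (hℓ : 0 < ℓ) {v : Fin ℓ → ℤ}
    (hv : v ∈ AddSubmonoid.closure (Set.range (simpleRootB ℓ))) : 0 ≤ v ⟨0, hℓ⟩ :=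
  AddMonoidHom.nonneg_of_mem_closure_range (Pi.evalAddMonoidHom (fun _ : Fin ℓ => ℤ) ⟨0, hℓ⟩)
    (simpleRootB_zero_nonneg hℓ) hv

theorem eq_quadBasis {ℓ a : ℕ} {v : Fin ℓ → ℤ} (hv : ∀ p q, p ≤ q → v q ≤ v p)
    (h0 : ∀ m, 0 ≤ v m) (h1 : ∀ m, v m ≤ 1) (hs : ∑ m, v m = a) : v = quadBasis ℓ a := by
  funext m
  by_cases hm : (m : ℕ) < a
  · by_contra hne
    have hvm : v m ≤ 0 := by grind [quadBasis]
    have hle : ∑ k, v k ≤ ∑ k, quadBasis ℓ m k := Finset.sum_le_sum fun k _ => by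
      by_cases hk : (k : ℕ) < m
      · simpa [quadBasis, hk] using h1 k
      · simpa [quadBasis, hk] using (hv m k (not_lt.mp hk)).trans hvm
    rw [sum_quadBasis m.2.le] at hle
    omega
  · by_contra hne
    have hvm : 1 ≤ v m := by grind [quadBasis]
    have hle : ∑ k, quadBasis ℓ (m + 1) k ≤ ∑ k, v k := Finset.sum_le_sum fun k _ => by
      by_cases hk : (k : ℕ) < m + 1
      · simpa [quadBasis, hk] using hvm.trans (hv k m (Nat.lt_succ_iff.mp hk))
      · simpa [quadBasis, hk] using h0 k
    rw [sum_quadBasis m.2] at hle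
    omega

theorem quadBasis_eq_of_sub_mem {ℓ a : ℕ} (hℓ : 0 < ℓ) {v : Fin ℓ → ℤ}
    (hv : ∀ p q, p ≤ q → v q ≤ v p) (h0 : ∀ m, 0 ≤ v m)
    (hmem : quadBasis ℓ a - v ∈ AddSubmonoid.closure (Set.range (simpleRootB ℓ)))
    (hs : ∑ m, v m = a) : v = quadBasis ℓ a := by
  have h := zero_nonneg_of_mem_closure_simpleRootB hℓ hmem
  have hq : quadBasis ℓ a ⟨0, hℓ⟩ ≤ 1 := by grind [quadBasis]
  rw [Pi.sub_apply] at h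
  exact eq_quadBasis hv h0 (fun m => (hv ⟨0, hℓ⟩ m (Nat.zero_le _)).trans (by omega)) hs

theorem sum_le_of_quadBasis_sub_mem {ℓ a : ℕ} (ha : a ≤ ℓ) {v : Fin ℓ → ℤ}
    (hmem : quadBasis ℓ a - v ∈ AddSubmonoid.closure (Set.range (simpleRootB ℓ))) :
    ∑ m, v m ≤ a := by
  have h := sum_nonneg_of_mem_closure_simpleRootB hmem
  simp only [Pi.sub_apply, Finset.sum_sub_distrib, sum_quadBasis ha] at h
  omega

theorem quadBasis_add_sub_eq_sum {ℓ a : ℕ} (ha : a < ℓ) :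
    quadBasis ℓ 1 + quadBasis ℓ a - quadBasis ℓ (a + 1) =
      ∑ k : Fin ℓ, if (k : ℕ) < a then simpleRootB ℓ k else 0 := by
  funext m
  have h : ∀ k : Fin ℓ, (if (k : ℕ) < a then simpleRootB ℓ k else 0) m =
      (if k = m then (if (m : ℕ) < a then 1 else 0) else 0) -
        if (k : ℕ) + 1 = m then (if (m : ℕ) ≤ a then 1 else 0) else 0 := by
    intro k
    split_ifs <;> simp only [simpleRootB, Fin.ext_iff, Pi.zero_apply] at * <;> grind
  have h' : (∑ k : Fin ℓ, if (k : ℕ) + 1 = m then (if (m : ℕ) ≤ a then (1 : ℤ) else 0) else 0) =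
      if 0 < (m : ℕ) ∧ (m : ℕ) ≤ a then 1 else 0 := by
    by_cases hm : (m : ℕ) = 0
    · simp [hm]
    · have hk : ∀ k : Fin ℓ, (k : ℕ) + 1 = m ↔ k = ⟨m - 1, by omega⟩ := by
        intro k
        rw [Fin.ext_iff]
        grind
      simp [hk, Nat.pos_of_ne_zero hm]
  simp only [Finset.sum_apply, h, Finset.sum_sub_distrib, h', Finset.sum_ite_eq',
    Finset.mem_univ, if_true]
  simp only [quadBasis, Pi.add_apply, Pi.sub_apply]
  grind


/-- **Lemma 7 of Chirivì–Littelmann–Maffei for a root system of type `B_ℓ`** (the same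
coordinates also cover type `BC_ℓ`).

Work in `ℤ^ℓ` with standard basis `e₁, …, e_ℓ` (coordinates `m : Fin ℓ` are
`0`-indexed).  The simple roots of type `B_ℓ` are `α_k = e_k - e_{k+1}` for
`1 ≤ k ≤ ℓ-1` and `α_ℓ = e_ℓ` (so `α_k` has `0`-indexed label `k-1`); set `ε_0 = 0` and
`ε_i = e₁ + … + e_i` for `1 ≤ i ≤ ℓ`, the quadratic basis.  Then for `1 ≤ i ≤ ℓ`:
(i) `ε_1 + ε_{i-1} - ε_i = α_1 + α_2 + … + α_{i-1}`, so `ε_i ≤ ε_1 + ε_{i-1}` in the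
dominant order; (ii) if `λ, μ` are dominant with `μ ≤ ε_1`, `λ ≤ ε_{i-1}` and
`ε_i ≤ λ + μ`, then `μ = ε_1` and `λ = ε_{i-1}`. -/
theorem lemma7_typeB (ℓ : ℕ) (hℓ : 1 ≤ ℓ) (i : ℕ) (hi : 1 ≤ i) (hiℓ : i ≤ ℓ) :
    let eps : ℕ → (Fin ℓ → ℤ) := fun a m => if (m : ℕ) < a then 1 else 0
    let α : Fin ℓ → (Fin ℓ → ℤ) := fun k m =>
      if (k : ℕ) + 1 = ℓ then (if m = k then 1 else 0)
      else if m = k then 1 else if (m : ℕ) = (k : ℕ) + 1 then -1 else 0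
    -- (i) ε_1 + ε_{i-1} - ε_i = α_1 + … + α_{i-1}, so ε_i ≤ ε_1 + ε_{i-1}
    ((eps 1 + eps (i - 1) - eps i = ∑ k : Fin ℓ, if (k : ℕ) < i - 1 then α k else 0) ∧
      eps 1 + eps (i - 1) - eps i ∈ AddSubmonoid.closure (Set.range α)) ∧
    -- (ii)
    (∀ lam mu : Fin ℓ → ℤ,
      (∀ p q : Fin ℓ, p ≤ q → lam q ≤ lam p) → (∀ m, 0 ≤ lam m) →
      (∀ p q : Fin ℓ, p ≤ q → mu q ≤ mu p) → (∀ m, 0 ≤ mu m) →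
      eps 1 - mu ∈ AddSubmonoid.closure (Set.range α) →
      eps (i - 1) - lam ∈ AddSubmonoid.closure (Set.range α) →
      (lam + mu) - eps i ∈ AddSubmonoid.closure (Set.range α) →
      mu = eps 1 ∧ lam = eps (i - 1)) := by
  intro eps α
  change ((quadBasis ℓ 1 + quadBasis ℓ (i - 1) - quadBasis ℓ i = _) ∧
    quadBasis ℓ 1 + quadBasis ℓ (i - 1) - quadBasis ℓ i ∈ _) ∧ _
  have hsum := quadBasis_add_sub_eq_sum (ℓ := ℓ) (a := i - 1) (by omega)
  rw [Nat.sub_add_cancel hi] at hsum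
  refine ⟨⟨hsum, ?_⟩, ?_⟩
  · rw [hsum]
    refine AddSubmonoid.sum_mem _ fun k _ => ?_
    split_ifs
    · exact AddSubmonoid.subset_closure ⟨k, rfl⟩
    · exact zero_mem _
  · intro lam mu hlam hlam0 hmu hmu0 hmuLe hlamLe hLe
    have h₁ := sum_le_of_quadBasis_sub_mem hℓ hmuLe
    have h₂ := sum_le_of_quadBasis_sub_mem (by omega) hlamLe
    have h₃ : 0 ≤ ∑ m, (lam + mu - quadBasis ℓ i) m :=
      sum_nonneg_of_mem_closure_simpleRootB hLe
    simp only [Pi.sub_apply, Pi.add_apply, Finset.sum_sub_distrib, Finset.sum_add_distrib,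
      sum_quadBasis hiℓ] at h₃
    exact ⟨quadBasis_eq_of_sub_mem hℓ hmu hmu0 hmuLe (by omega),
      quadBasis_eq_of_sub_mem hℓ hlam hlam0 hlamLe (by omega)⟩
end

section
/- Let ℓ ≥ 1 and 1 ≤ i ≤ ℓ (type C_ℓ setup). Then: (i) ε_1 + ε_{i−1} − ε_i = α_1 + α_2 + … + α_{i−1}, so ε_i ≤ ε_1 + ε_{i−1} in the dominant order; (ii) if λ, μ ∈ ℤ^ℓ are dominant and satisfy μ ≤ ε_1, λ ≤ ε_{i−1} and ε_i ≤ λ + μ, then μ = ε_1 and λ = ε_{i−1}. -/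
/-- The fundamental weight `e₁ + … + e_a` of type `C_ℓ` (zero for `a = 0`). -/
def typeCWeight (ℓ a : ℕ) : Fin ℓ → ℤ := fun m => if (m : ℕ) < a then 1 else 0

/-- The simple roots of type `C_ℓ`, indexed from zero. -/
def typeCRoot (ℓ : ℕ) (k : Fin ℓ) : Fin ℓ → ℤ := fun m =>
  if (k : ℕ) + 1 = ℓ then (if m = k then 2 else 0)
  else if m = k then 1 else if (m : ℕ) = (k : ℕ) + 1 then -1 else 0

theorem sum_typeCWeight {ℓ a : ℕ} (ha : a ≤ ℓ) : ∑ m, typeCWeight ℓ a m = a := by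
  simp [typeCWeight, Finset.sum_boole, Fin.card_filter_val_lt, ha]

theorem sum_typeCRoot_lt {ℓ j : ℕ} (hj : j < ℓ) :
    ∑ k : Fin ℓ, (if (k : ℕ) < j then typeCRoot ℓ k else 0) =
      typeCWeight ℓ 1 + typeCWeight ℓ j - typeCWeight ℓ (j + 1) := by
  induction j with
  | zero => ext m; simp [typeCWeight]
  | succ j ih =>
    have hsplit : ∀ k : Fin ℓ, (if (k : ℕ) < j + 1 then typeCRoot ℓ k else 0) =
        (if (k : ℕ) < j then typeCRoot ℓ k else 0) +
          (if k = ⟨j, by omega⟩ then typeCRoot ℓ k else 0) := by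
      intro k
      rcases lt_trichotomy (k : ℕ) j with h | h | h
      · simp [Fin.ext_iff, h, h.ne, Nat.lt_succ_of_lt h]
      · simp [Fin.ext_iff, h]
      · simp [Fin.ext_iff, h.ne', show ¬ (k : ℕ) < j + 1 by omega, show ¬ (k : ℕ) < j by omega]
    simp_rw [hsplit]
    rw [Finset.sum_add_distrib, ih (by omega), Finset.sum_ite_eq' Finset.univ]
    ext m
    simp only [typeCWeight, typeCRoot, Pi.add_apply, Pi.sub_apply, Finset.mem_univ, if_true,
      Fin.ext_iff]
    split_ifs <;> omega

/-- The coordinate sum of a simple root is `2` for the long root and `0` otherwise. -/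
theorem sum_typeCRoot {ℓ : ℕ} (k : Fin ℓ) :
    ∑ m, typeCRoot ℓ k m = if (k : ℕ) + 1 = ℓ then 2 else 0 := by
  unfold typeCRoot
  split_ifs with h
  · simp
  · have hlt : (k : ℕ) + 1 < ℓ := by omega
    have hsplit : ∀ m : Fin ℓ,
        (if m = k then (1 : ℤ) else if (m : ℕ) = (k : ℕ) + 1 then -1 else 0) =
          (if m = k then 1 else 0) + (if m = ⟨k + 1, hlt⟩ then -1 else 0) := by
      intro m
      simp only [Fin.ext_iff]
      split_ifs <;> omega
    simp [hsplit, Finset.sum_add_distrib]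

theorem nonneg_and_sum_eq_of_mem_closure_typeCRoot {ℓ : ℕ} (hℓ : 0 < ℓ) {x : Fin ℓ → ℤ}
    (hx : x ∈ AddSubmonoid.closure (Set.range (typeCRoot ℓ))) :
    0 ≤ x ⟨0, hℓ⟩ ∧ ∃ n : ℕ, ∑ m, x m = 2 * n := by
  induction hx using AddSubmonoid.closure_induction with
  | mem x hx =>
    obtain ⟨k, rfl⟩ := hx
    constructor
    · simp only [typeCRoot, Fin.ext_iff]
      split_ifs <;> simp_all
    · rw [sum_typeCRoot]
      split_ifs
      · exact ⟨1, by norm_num⟩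
      · exact ⟨0, by norm_num⟩
  | zero => exact ⟨le_rfl, 0, by simp⟩
  | add x y _ _ hx hy =>
    obtain ⟨hx, n, hn⟩ := hx
    obtain ⟨hy, n', hn'⟩ := hy
    refine ⟨add_nonneg hx hy, n + n', ?_⟩
    simp only [Pi.add_apply, Finset.sum_add_distrib, hn, hn']
    push_cast
    ring

/-- An antitone vector with entries in `{0, 1}` is determined by its coordinate sum. -/
theorem eq_typeCWeight_of_sum_eq {ℓ a : ℕ} (ha : a ≤ ℓ) (hℓ : 0 < ℓ) {f : Fin ℓ → ℤ}
    (hf : ∀ p q : Fin ℓ, p ≤ q → f q ≤ f p) (h0 : ∀ m, 0 ≤ f m) (h1 : f ⟨0, hℓ⟩ ≤ 1)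
    (hsum : ∑ m, f m = a) : f = typeCWeight ℓ a := by
  have hle : ∀ m, f m ≤ 1 := fun m => (hf _ m (Nat.zero_le _)).trans h1
  rw [← sum_typeCWeight ha] at hsum
  by_cases h : ∃ m : Fin ℓ, (m : ℕ) < a ∧ f m ≤ 0
  · obtain ⟨p, hp, hfp⟩ := h
    have hfw : ∀ m ∈ Finset.univ, f m ≤ typeCWeight ℓ a m := by
      intro m _
      unfold typeCWeight
      split_ifs with hm
      · exact hle m
      · exact (hf p m (Fin.le_def.2 (by omega))).trans hfp
    exact funext fun m => (Finset.sum_eq_sum_iff_of_le hfw).1 hsum m (Finset.mem_univ m)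
  · push Not at h
    have hwf : ∀ m ∈ Finset.univ, typeCWeight ℓ a m ≤ f m := by
      intro m _
      unfold typeCWeight
      split_ifs with hm
      · exact h m hm
      · exact h0 m
    exact funext fun m =>
      ((Finset.sum_eq_sum_iff_of_le hwf).1 hsum.symm m (Finset.mem_univ m)).symm

/-- **Lemma 7 of Chirivì–Littelmann–Maffei for a root system of type `C_ℓ`**.

Work in `ℤ^ℓ` with standard basis `e₁, …, e_ℓ` (coordinates `m : Fin ℓ` are
`0`-indexed).  The simple roots of type `C_ℓ` are `α_k = e_k - e_{k+1}` for
`1 ≤ k ≤ ℓ-1` and `α_ℓ = 2e_ℓ` (so `α_k` has `0`-indexed label `k-1`); set `ε_0 = 0` and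
`ε_i = e₁ + … + e_i` for `1 ≤ i ≤ ℓ`, the fundamental weights of `C_ℓ`.  Then for `1 ≤ i ≤ ℓ`:
(i) `ε_1 + ε_{i-1} - ε_i = α_1 + α_2 + … + α_{i-1}`, so `ε_i ≤ ε_1 + ε_{i-1}` in the
dominant order; (ii) if `λ, μ` are dominant with `μ ≤ ε_1`, `λ ≤ ε_{i-1}` and
`ε_i ≤ λ + μ`, then `μ = ε_1` and `λ = ε_{i-1}`. -/
theorem lemma7_typeC (ℓ : ℕ) (hℓ : 1 ≤ ℓ) (i : ℕ) (hi : 1 ≤ i) (hiℓ : i ≤ ℓ) :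
    let eps : ℕ → (Fin ℓ → ℤ) := fun a m => if (m : ℕ) < a then 1 else 0
    let α : Fin ℓ → (Fin ℓ → ℤ) := fun k m =>
      if (k : ℕ) + 1 = ℓ then (if m = k then 2 else 0)
      else if m = k then 1 else if (m : ℕ) = (k : ℕ) + 1 then -1 else 0
    -- (i) ε_1 + ε_{i-1} - ε_i = α_1 + … + α_{i-1}, so ε_i ≤ ε_1 + ε_{i-1}
    ((eps 1 + eps (i - 1) - eps i = ∑ k : Fin ℓ, if (k : ℕ) < i - 1 then α k else 0) ∧
      eps 1 + eps (i - 1) - eps i ∈ AddSubmonoid.closure (Set.range α)) ∧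
    -- (ii)
    (∀ lam mu : Fin ℓ → ℤ,
      (∀ p q : Fin ℓ, p ≤ q → lam q ≤ lam p) → (∀ m, 0 ≤ lam m) →
      (∀ p q : Fin ℓ, p ≤ q → mu q ≤ mu p) → (∀ m, 0 ≤ mu m) →
      eps 1 - mu ∈ AddSubmonoid.closure (Set.range α) →
      eps (i - 1) - lam ∈ AddSubmonoid.closure (Set.range α) →
      (lam + mu) - eps i ∈ AddSubmonoid.closure (Set.range α) →
      mu = eps 1 ∧ lam = eps (i - 1)) := by
  intro eps α
  have heps : eps = typeCWeight ℓ := rfl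
  have hα : α = typeCRoot ℓ := rfl
  clear_value eps α
  subst heps hα
  obtain ⟨j, rfl⟩ : ∃ j, i = j + 1 := ⟨i - 1, by omega⟩
  simp only [Nat.add_sub_cancel]
  have hroots := sum_typeCRoot_lt (show j < ℓ by omega)
  refine ⟨⟨hroots.symm, ?_⟩, ?_⟩
  · rw [← hroots]
    refine AddSubmonoid.sum_mem _ fun k _ => ?_
    split_ifs
    · exact AddSubmonoid.subset_closure ⟨k, rfl⟩
    · exact zero_mem _
  · intro lam mu hlam hlam0 hmu hmu0 h₁ h₂ h₃
    obtain ⟨hmu1, n₁, hn₁⟩ := nonneg_and_sum_eq_of_mem_closure_typeCRoot hℓ h₁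
    obtain ⟨hlam1, n₂, hn₂⟩ := nonneg_and_sum_eq_of_mem_closure_typeCRoot hℓ h₂
    obtain ⟨-, n₃, hn₃⟩ := nonneg_and_sum_eq_of_mem_closure_typeCRoot hℓ h₃
    simp only [Pi.sub_apply, Pi.add_apply, Finset.sum_sub_distrib, Finset.sum_add_distrib,
      sum_typeCWeight hℓ, sum_typeCWeight hiℓ, sum_typeCWeight (show j ≤ ℓ by omega)]
      at hn₁ hn₂ hn₃
    have hmu_sum : 0 ≤ ∑ m, mu m := Finset.sum_nonneg fun m _ => hmu0 m
    have hle : ∀ a, typeCWeight ℓ a ⟨0, hℓ⟩ ≤ 1 := by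
      intro a
      unfold typeCWeight
      split_ifs <;> norm_num
    push_cast at hn₁ hn₂ hn₃
    exact ⟨eq_typeCWeight_of_sum_eq hℓ hℓ hmu hmu0 ((sub_nonneg.1 hmu1).trans (hle 1))
        (by push_cast; omega),
      eq_typeCWeight_of_sum_eq (by omega) hℓ hlam hlam0 ((sub_nonneg.1 hlam1).trans (hle j))
        (by omega)⟩
end

section
/- Let V be a finite-dimensional real inner product space and Φ ⊆ V a finite set of nonzero vectors such that for every α ∈ Φ the orthogonal reflection s_α in the hyperplane orthogonal to α maps Φ onto itself; let W be the subgroup of the orthogonal group of V generated by the reflections s_α, α ∈ Φ. Let f : V → ℝ be a linear functional with f(α) ≠ 0 for all α ∈ Φ, and set Φ⁺ = {α ∈ Φ : f(α) > 0}. Let σ : V → V be a linear isometric involution with σ(Φ) = Φ such that for every α ∈ Φ⁺ either σ(α) = α or −σ(α) ∈ Φ⁺, and set Φ₀ = {α ∈ Φ : σ(α) = α}. Suppose w ∈ W satisfies w(Φ⁺) = −Φ⁺ (so w is the longest element of W) and w(Φ₀) = Φ₀. Then w ∘ σ = σ ∘ w. -/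
open scoped RealInnerProductSpace

section RootReflection

open Submodule

variable {V : Type*} [NormedAddCommGroup V] [InnerProductSpace ℝ V]

/-- The orthogonal reflection in the hyperplane orthogonal to `α`. -/
noncomputable def rootReflection (α : V) : V ≃ₗᵢ[ℝ] V := (ℝ ∙ α)ᗮ.reflection

lemma rootReflection_apply (α x : V) :
    rootReflection α x = x - (2 * ⟪x, α⟫ / ⟪α, α⟫) • α := by
  rw [rootReflection, reflection_orthogonal_apply, reflection_singleton_apply,
    real_inner_self_eq_norm_sq, real_inner_comm x α, neg_sub, ← Nat.cast_smul_eq_nsmul ℝ 2,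
    smul_smul]
  norm_num [mul_div_assoc]

lemma rootReflection_self (α : V) : rootReflection α α = -α :=
  reflection_orthogonalComplement_singleton_eq_neg α

lemma rootReflection_mul_self (α : V) : rootReflection α * rootReflection α = 1 :=
  reflection_mul_reflection _

lemma rootReflection_inv (α : V) : (rootReflection α)⁻¹ = rootReflection α :=
  reflection_inv

lemma mul_rootReflection (g : V ≃ₗᵢ[ℝ] V) (α : V) :
    g * rootReflection α = rootReflection (g α) * g := by
  ext x
  simp [rootReflection_apply]

lemma rootReflection_eq_of_mem_span {α β : V} (hβ : β ≠ 0) (h : β ∈ ℝ ∙ α) :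
    rootReflection β = rootReflection α := by
  obtain ⟨k, rfl⟩ := mem_span_singleton.1 h
  have hk : k ≠ 0 := by rintro rfl; simp at hβ
  simp only [rootReflection, span_singleton_smul_eq hk.isUnit]

lemma eq_zero_or_pos_of_mem_span_nnreal {Δ : Set V} {f : V →ₗ[ℝ] ℝ} (hΔ : ∀ α ∈ Δ, 0 < f α)
    {x : V} (hx : x ∈ span NNReal Δ) : x = 0 ∨ 0 < f x := by
  induction hx using span_induction with
  | mem x hx => exact .inr (hΔ x hx)
  | zero => exact .inl rfl
  | add x y _ _ hx hy =>
    rcases hx with rfl | hx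
    · simpa using hy
    · rcases hy with rfl | hy
      · simpa using Or.inr hx
      · exact .inr (by rw [map_add]; positivity)
  | smul k x _ hx =>
    rcases hx with rfl | hx
    · simp
    · rcases eq_or_ne k 0 with rfl | hk
      · simp
      · refine .inr ?_
        rw [NNReal.smul_def, map_smul, smul_eq_mul]
        exact mul_pos (by exact_mod_cast pos_iff_ne_zero.2 hk) hx

lemma inner_nonpos_of_mem_span_nnreal {Δ : Set V} {β : V} (hΔ : ∀ α ∈ Δ, ⟪β, α⟫ ≤ 0)
    {x : V} (hx : x ∈ span NNReal Δ) : ⟪β, x⟫ ≤ 0 := by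
  induction hx using span_induction with
  | mem x hx => exact hΔ x hx
  | zero => simp
  | add x y _ _ hx hy => rw [inner_add_right]; linarith
  | smul k x _ hx =>
    rw [NNReal.smul_def, real_inner_smul_right]
    exact mul_nonpos_of_nonneg_of_nonpos k.2 hx

/-- A finite set contains a minimal subset generating the same convex cone. -/
lemma exists_minimal_cone_generators {P : Set V} (hP : P.Finite) :
    ∃ Δ ⊆ P, P ⊆ span NNReal Δ ∧ ∀ α ∈ Δ, α ∉ span NNReal (Δ \ {α}) := by
  have hfin : {Δ : Set V | Δ ⊆ P ∧ P ⊆ span NNReal Δ}.Finite :=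
    hP.finite_subsets.subset fun _ h => h.1
  obtain ⟨Δ, hΔ⟩ := hfin.exists_minimal ⟨P, subset_rfl, subset_span⟩
  refine ⟨Δ, hΔ.prop.1, hΔ.prop.2, fun α hα hmem => ?_⟩
  have hle : span NNReal Δ ≤ span NNReal (Δ \ {α}) := by
    refine span_le.2 fun β hβ => ?_
    by_cases h : β = α
    · exact h ▸ hmem
    · exact subset_span ⟨hβ, h⟩
  exact (hΔ.le_of_le ⟨Set.sdiff_subset.trans hΔ.prop.1, hΔ.prop.2.trans hle⟩
    Set.sdiff_subset hα).2 rfl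

variable {Φ Δ : Set V} {f : V →ₗ[ℝ] ℝ}

/-- A simple reflection permutes the positive roots not proportional to its root. -/
lemma rootReflection_pos (hΦ : ∀ α ∈ Φ, ∀ β ∈ Φ, rootReflection α β ∈ Φ)
    (hf : ∀ α ∈ Φ, f α ≠ 0) (hΔΦ : Δ ⊆ {α ∈ Φ | 0 < f α})
    (hspan : {α ∈ Φ | 0 < f α} ⊆ span NNReal Δ)
    (hmin : ∀ α ∈ Δ, α ∉ span NNReal (Δ \ {α})) {α β : V} (hα : α ∈ Δ) (hβ : β ∈ Φ)
    (hfβ : 0 < f β) (hαβ : β ∉ ℝ ∙ α) : 0 < f (rootReflection α β) := by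
  by_contra hneg
  have hrΦ := hΦ α (hΔΦ hα).1 β hβ
  have hlt : f (rootReflection α β) < 0 := lt_of_le_of_ne (not_lt.1 hneg) (hf _ hrΦ)
  have hnegΦ : -rootReflection α β ∈ {α ∈ Φ | 0 < f α} := by
    refine ⟨?_, by simpa using hlt⟩
    simpa [rootReflection_self] using hΦ _ hrΦ _ hrΦ
  have hins : insert α (Δ \ {α}) = Δ := by simp [hα]
  have h1 := hspan ⟨hβ, hfβ⟩
  have h2 := hspan hnegΦ
  rw [SetLike.mem_coe, ← hins, mem_span_insert] at h1 h2
  obtain ⟨p, x, hx, hpx⟩ := h1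
  obtain ⟨q, y, hy, hqy⟩ := h2
  have hpos : ∀ γ ∈ Δ \ {α}, 0 < f γ := fun γ hγ => (hΔΦ hγ.1).2
  have hx0 : x ≠ 0 := by
    rintro rfl
    exact hαβ (mem_span_singleton.2 ⟨p, by rw [hpx, add_zero, NNReal.smul_def]⟩)
  have hfx := (eq_zero_or_pos_of_mem_span_nnreal hpos hx).resolve_left hx0
  have hfy : 0 ≤ f y := by
    rcases eq_zero_or_pos_of_mem_span_nnreal hpos hy with rfl | h
    · simp
    · exact h.le
  rw [rootReflection_apply] at hqy
  set k := 2 * ⟪β, α⟫ / ⟪α, α⟫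
  have hxy : (k - p - q) • α = x + y := by
    have hsum : k • α = (p : ℝ) • α + x + ((q : ℝ) • α + y) := by
      rw [← NNReal.smul_def, ← NNReal.smul_def, ← hqy, ← hpx]
      abel
    rw [sub_smul, sub_smul, hsum]
    abel
  have ht : 0 < k - p - q := by
    have := congrArg f hxy
    rw [map_smul, map_add, smul_eq_mul] at this
    exact pos_of_mul_pos_left (by linarith) (hΔΦ hα).2.le
  refine hmin α hα ?_
  have hmem := smul_mem _ (k - p - q).toNNReal⁻¹ (add_mem hx hy)
  rw [← hxy, NNReal.smul_def, smul_smul] at hmem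
  rwa [NNReal.coe_inv, Real.coe_toNNReal _ ht.le, inv_mul_cancel₀ ht.ne', one_smul] at hmem

/-- The simple reflections generate the reflection group. -/
lemma rootReflection_mem_closure_simple (hfin : Φ.Finite)
    (hΦ : ∀ α ∈ Φ, ∀ β ∈ Φ, rootReflection α β ∈ Φ)
    (hf : ∀ α ∈ Φ, f α ≠ 0) (hΔΦ : Δ ⊆ {α ∈ Φ | 0 < f α})
    (hspan : {α ∈ Φ | 0 < f α} ⊆ span NNReal Δ)
    (hpos : ∀ α ∈ Δ, ∀ β ∈ Φ, 0 < f β → β ∉ ℝ ∙ α → 0 < f (rootReflection α β))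
    {β : V} (hβ : β ∈ Φ) :
    rootReflection β ∈ Subgroup.closure (rootReflection '' Δ) := by
  have key : ∀ β ∈ Φ, 0 < f β → rootReflection β ∈ Subgroup.closure (rootReflection '' Δ) := by
    intro β hβ
    have hwf : Φ.WellFoundedOn (fun a b => f a < f b) :=
      hfin.wellFoundedOn (r := (f · < f ·))
    refine hwf.induction
      (P := fun β => 0 < f β → rootReflection β ∈ Subgroup.closure (rootReflection '' Δ)) hβ ?_
    intro β hβ ih hfβ
    have hβ0 : β ≠ 0 := by rintro rfl; simp at hfβ
    by_cases hprop : ∃ α ∈ Δ, β ∈ ℝ ∙ α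
    · obtain ⟨α, hα, h⟩ := hprop
      rw [rootReflection_eq_of_mem_span hβ0 h]
      exact Subgroup.subset_closure ⟨α, hα, rfl⟩
    push Not at hprop
    obtain ⟨α, hα, hin⟩ : ∃ α ∈ Δ, 0 < ⟪β, α⟫ := by
      by_contra! h
      exact (inner_nonpos_of_mem_span_nnreal h (hspan ⟨hβ, hfβ⟩)).not_gt
        (real_inner_self_pos.2 hβ0)
    have hα0 : α ≠ 0 := by rintro rfl; simp at hin
    have hmem : rootReflection α ∈ Subgroup.closure (rootReflection '' Δ) :=
      Subgroup.subset_closure ⟨α, hα, rfl⟩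
    have hlt : f (rootReflection α β) < f β := by
      rw [rootReflection_apply, map_sub, map_smul, smul_eq_mul]
      have hk : 0 < 2 * ⟪β, α⟫ / ⟪α, α⟫ := by
        have := real_inner_self_pos.2 hα0
        positivity
      linarith [mul_pos hk (hΔΦ hα).2]
    have hrec := ih _ (hΦ α (hΔΦ hα).1 β hβ) hlt (hpos α hα β hβ hfβ (hprop α hα))
    have heq : rootReflection β =
        rootReflection α * (rootReflection (rootReflection α β) * rootReflection α) := by
      rw [← mul_rootReflection, ← mul_assoc, rootReflection_mul_self, one_mul]
    rw [heq]
    exact mul_mem hmem (mul_mem hrec hmem)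
  rcases (hf β hβ).lt_or_gt with h | h
  · have hβ0 : β ≠ 0 := by rintro rfl; simp at h
    have hneg : -β ∈ Φ := by simpa [rootReflection_self] using hΦ β hβ β hβ
    rw [rootReflection_eq_of_mem_span (α := -β) hβ0 (mem_span_singleton.2 ⟨-1, by simp⟩)]
    exact key _ hneg (by simpa using h)
  · exact key β hβ h

lemma list_prod_rootReflection_mem (hΦ : ∀ α ∈ Φ, ∀ β ∈ Φ, rootReflection α β ∈ Φ)
    {L : List V} (hL : ∀ α ∈ L, α ∈ Φ) {β : V} (hβ : β ∈ Φ) :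
    (L.map rootReflection).prod β ∈ Φ := by
  induction L with
  | nil => simpa using hβ
  | cons a L ih =>
    rw [List.forall_mem_cons] at hL
    simpa using hΦ a hL.1 _ (ih hL.2)

/-- The exchange condition for words in simple reflections. -/
lemma exchange_rootReflection (hΦ : ∀ α ∈ Φ, ∀ β ∈ Φ, rootReflection α β ∈ Φ)
    (hf : ∀ α ∈ Φ, f α ≠ 0) (hΔΦ : Δ ⊆ {α ∈ Φ | 0 < f α})
    (hpos : ∀ α ∈ Δ, ∀ β ∈ Φ, 0 < f β → β ∉ ℝ ∙ α → 0 < f (rootReflection α β))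
    {α : V} (hα : α ∈ Δ) (L : List V) (hL : ∀ β ∈ L, β ∈ Δ)
    (hneg : f ((L.map rootReflection).prod α) < 0) :
    ∃ L' : List V, (∀ β ∈ L', β ∈ Δ) ∧ L'.length < L.length ∧
      (L.map rootReflection).prod = (L'.map rootReflection).prod * rootReflection α := by
  induction L with
  | nil => exact absurd hneg (by simpa using (hΔΦ hα).2.le)
  | cons a L ih =>
    rw [List.forall_mem_cons] at hL
    have hβ := list_prod_rootReflection_mem hΦ (fun β hβ => (hΔΦ (hL.2 β hβ)).1) (hΔΦ hα).1
    rcases (hf _ hβ).lt_or_gt with h | h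
    · obtain ⟨L', hL', hlen, heq⟩ := ih hL.2 h
      exact ⟨a :: L', List.forall_mem_cons.2 ⟨hL.1, hL'⟩, by simpa using hlen,
        by simp [heq, mul_assoc]⟩
    · refine ⟨L, hL.2, by simp, ?_⟩
      have hspan : (L.map rootReflection).prod α ∈ ℝ ∙ a := by
        by_contra hn
        exact (hpos a hL.1 _ hβ h hn).not_gt (by simpa using hneg)
      have h0 : (L.map rootReflection).prod α ≠ 0 := fun h0 => by simp [h0] at h
      rw [mul_rootReflection, rootReflection_eq_of_mem_span h0 hspan, List.map_cons,
        List.prod_cons]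

lemma list_prod_rootReflection_eq_one (hΦ : ∀ α ∈ Φ, ∀ β ∈ Φ, rootReflection α β ∈ Φ)
    (hf : ∀ α ∈ Φ, f α ≠ 0) (hΔΦ : Δ ⊆ {α ∈ Φ | 0 < f α})
    (hpos : ∀ α ∈ Δ, ∀ β ∈ Φ, 0 < f β → β ∉ ℝ ∙ α → 0 < f (rootReflection α β))
    (L : List V) (hL : ∀ β ∈ L, β ∈ Δ)
    (hfix : ∀ α ∈ Δ, 0 < f ((L.map rootReflection).prod α)) :
    (L.map rootReflection).prod = 1 := by
  induction hn : L.length using Nat.strong_induction_on generalizing L with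
  | _ n ih =>
    rcases List.eq_nil_or_concat' L with rfl | ⟨M, α, rfl⟩
    · simp
    have hα : α ∈ Δ := hL α (by simp)
    have hprod : ((M ++ [α]).map rootReflection).prod =
        (M.map rootReflection).prod * rootReflection α := by simp
    have hneg : f ((M.map rootReflection).prod α) < 0 := by
      have := hfix α hα
      rw [hprod, LinearIsometryEquiv.coe_mul, Function.comp_apply, rootReflection_self, map_neg,
        map_neg] at this
      linarith
    obtain ⟨L', hL', hlen, heq⟩ :=
      exchange_rootReflection hΦ hf hΔΦ hpos hα M (fun β hβ => hL β (by simp [hβ])) hneg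
    rw [hprod, heq, mul_assoc, rootReflection_mul_self, mul_one] at hfix ⊢
    exact ih _ (by simp at hn; omega) L' hL' hfix rfl

/-- An element of a finite reflection group preserving the positive roots is trivial. -/
theorem eq_one_of_mem_closure_rootReflection (hfin : Φ.Finite)
    (hΦ : ∀ α ∈ Φ, ∀ β ∈ Φ, rootReflection α β ∈ Φ) (hf : ∀ α ∈ Φ, f α ≠ 0)
    {g : V ≃ₗᵢ[ℝ] V} (hg : g ∈ Subgroup.closure (rootReflection '' Φ))
    (hfix : ∀ α ∈ Φ, 0 < f α → 0 < f (g α)) : g = 1 := by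
  obtain ⟨Δ, hΔΦ, hspan, hmin⟩ :=
    exists_minimal_cone_generators (hfin.subset (Set.sep_subset Φ (0 < f ·)))
  have hpos : ∀ α ∈ Δ, ∀ β ∈ Φ, 0 < f β → β ∉ ℝ ∙ α → 0 < f (rootReflection α β) :=
    fun α hα β hβ => rootReflection_pos hΦ hf hΔΦ hspan hmin hα hβ
  have hle : Subgroup.closure (rootReflection '' Φ) ≤ Subgroup.closure (rootReflection '' Δ) := by
    rw [Subgroup.closure_le]
    rintro _ ⟨β, hβ, rfl⟩
    exact rootReflection_mem_closure_simple hfin hΦ hf hΔΦ hspan hpos hβ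
  obtain ⟨L, hL, rfl⟩ : ∃ L : List V, (∀ β ∈ L, β ∈ Δ) ∧ (L.map rootReflection).prod = g := by
    refine Subgroup.closure_induction_left
      (p := fun g _ => ∃ L : List V, (∀ β ∈ L, β ∈ Δ) ∧ (L.map rootReflection).prod = g)
      ⟨[], by simp⟩ ?_ ?_ (hle hg)
    · rintro _ ⟨α, hα, rfl⟩ _ _ ⟨L, hL, rfl⟩
      exact ⟨α :: L, List.forall_mem_cons.2 ⟨hα, hL⟩, by simp⟩
    · rintro _ ⟨α, hα, rfl⟩ _ _ ⟨L, hL, rfl⟩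
      exact ⟨α :: L, List.forall_mem_cons.2 ⟨hα, hL⟩, by simp [rootReflection_inv]⟩
  exact list_prod_rootReflection_eq_one hΦ hf hΔΦ hpos L hL
    fun α hα => hfix α (hΔΦ hα).1 (hΔΦ hα).2

/-- An isometry preserving the roots normalizes the reflection group. -/
lemma conj_mem_closure_rootReflection {σ : V ≃ₗᵢ[ℝ] V} (hσ : ∀ α ∈ Φ, σ α ∈ Φ)
    {g : V ≃ₗᵢ[ℝ] V} (hg : g ∈ Subgroup.closure (rootReflection '' Φ)) :
    σ * g * σ⁻¹ ∈ Subgroup.closure (rootReflection '' Φ) := by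
  have hle : Subgroup.closure (rootReflection '' Φ) ≤
      (Subgroup.closure (rootReflection '' Φ)).comap (MulAut.conj σ).toMonoidHom := by
    rw [Subgroup.closure_le]
    rintro _ ⟨α, hα, rfl⟩
    refine Subgroup.subset_closure ⟨σ α, hσ α hα, ?_⟩
    simp [mul_rootReflection]
  exact hle hg

end RootReflection

/-- **The longest element of the Weyl group commutes with the involution**
(Proposition 28(ii) of Chirivì–Littelmann–Maffei).

Let `V` be a finite dimensional real inner product space and `Φ ⊆ V` a finite set of
nonzero vectors stable under each of the orthogonal reflections
`s_α : x ↦ x - (2⟪x,α⟫/⟪α,α⟫) α` for `α ∈ Φ`, and let `W` be the subgroup of the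
orthogonal group of `V` (realized as linear isometric equivalences) generated by these
reflections.  Let `f` be a linear functional not vanishing on `Φ`, defining the positive
system `Φ⁺ = {α ∈ Φ : f(α) > 0}`.  Let `σ` be a linear isometric involution of `V`
preserving `Φ` such that every `α ∈ Φ⁺` satisfies `σ(α) = α` or `-σ(α) ∈ Φ⁺`, and let
`Φ₀` be the set of `σ`-fixed roots.  If `w ∈ W` satisfies `w(Φ⁺) = -Φ⁺` (so `w` is the
longest element of `W`) and `w(Φ₀) = Φ₀`, then `w ∘ σ = σ ∘ w`. -/
theorem longest_element_commutes_with_involution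
    (V : Type*) [NormedAddCommGroup V] [InnerProductSpace ℝ V] [FiniteDimensional ℝ V]
    (Φ : Set V) (hfin : Φ.Finite) (h0 : ∀ α ∈ Φ, α ≠ 0)
    (s : V → V → V)
    (hs : ∀ α x, s α x = x - (2 * ⟪x, α⟫ / ⟪α, α⟫) • α)
    (hsΦ : ∀ α ∈ Φ, s α '' Φ = Φ)
    (W : Subgroup (V ≃ₗᵢ[ℝ] V))
    (hW : W = Subgroup.closure {w : V ≃ₗᵢ[ℝ] V | ∃ α ∈ Φ, ∀ x, w x = s α x})
    (f : V →ₗ[ℝ] ℝ) (hf : ∀ α ∈ Φ, f α ≠ 0)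
    (Φp : Set V) (hΦp : Φp = {α ∈ Φ | 0 < f α})
    (σ : V ≃ₗᵢ[ℝ] V) (hσ2 : ∀ x, σ (σ x) = x) (hσΦ : ⇑σ '' Φ = Φ)
    (hσpos : ∀ α ∈ Φp, σ α = α ∨ -σ α ∈ Φp)
    (Φ0 : Set V) (hΦ0 : Φ0 = {α ∈ Φ | σ α = α})
    (w : V ≃ₗᵢ[ℝ] V) (hw : w ∈ W)
    (hwlong : ⇑w '' Φp = -Φp)
    (hw0 : ⇑w '' Φ0 = Φ0) :
    ∀ x, w (σ x) = σ (w x) := by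
  have hsr : ∀ α x, s α x = rootReflection α x := fun α x => by rw [hs, rootReflection_apply]
  have hΦ : ∀ α ∈ Φ, ∀ β ∈ Φ, rootReflection α β ∈ Φ := fun α hα β hβ => by
    rw [← hsr, ← hsΦ α hα]
    exact ⟨β, hβ, rfl⟩
  have hWr : W = Subgroup.closure (rootReflection '' Φ) := by
    rw [hW]
    congr 1
    ext g
    simp [hsr, LinearIsometryEquiv.ext_iff, eq_comm]
  have hσm : ∀ α ∈ Φ, σ α ∈ Φ := fun α hα => hσΦ ▸ ⟨α, hα, rfl⟩
  have hneg : ∀ α ∈ Φ, -α ∈ Φ := fun α hα => by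
    simpa [rootReflection_self] using hΦ α hα α hα
  rw [hWr] at hw
  subst hΦp hΦ0
  have hwpos : ∀ α ∈ Φ, 0 < f α → w α ∈ Φ ∧ f (w α) < 0 := fun α hα h => by
    have h1 : w α ∈ -{α ∈ Φ | 0 < f α} := hwlong ▸ ⟨α, ⟨hα, h⟩, rfl⟩
    exact ⟨by simpa using hneg _ h1.1, by simpa using h1.2⟩
  have hwsymm : ∀ α ∈ Φ, f α < 0 → 0 < f (w⁻¹ α) := fun α hα h => by
    have h1 : α ∈ -{α ∈ Φ | 0 < f α} := ⟨hneg α hα, by simpa using h⟩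
    rw [← hwlong] at h1
    obtain ⟨β, hβ, rfl⟩ := h1
    simpa using hβ.2
  have hone : w⁻¹ * (σ * w * σ⁻¹) = 1 := by
    refine eq_one_of_mem_closure_rootReflection hfin hΦ hf
      (mul_mem (inv_mem hw) (conj_mem_closure_rootReflection hσm hw)) fun α hα hfα => ?_
    have hσinv : σ⁻¹ α = σ α := by
      rw [LinearIsometryEquiv.inv_def, LinearIsometryEquiv.symm_apply_eq, hσ2]
    simp only [LinearIsometryEquiv.coe_mul, Function.comp_apply, hσinv]
    by_cases hfix : σ α = α
    · have h1 : w α ∈ {α ∈ Φ | σ α = α} := hw0 ▸ ⟨α, ⟨hα, hfix⟩, rfl⟩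
      rw [hfix, h1.2]
      simpa using hfα
    · have hσα : -σ α ∈ {α ∈ Φ | 0 < f α} := (hσpos α ⟨hα, hfα⟩).resolve_left hfix
      obtain ⟨hmem, hlt⟩ := hwpos _ hσα.1 hσα.2
      have hmem' : w (σ α) ∈ Φ := by simpa using hneg _ hmem
      have hpos : 0 < f (w (σ α)) := by simpa using hlt
      refine hwsymm _ (hσm _ hmem') ?_
      rcases hσpos _ ⟨hmem', hpos⟩ with h | h
      · have h1 : w (σ α) ∈ {α ∈ Φ | σ α = α} := ⟨hmem', h⟩
        rw [← hw0] at h1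
        obtain ⟨β, hβ, hβα⟩ := h1
        obtain rfl := w.injective hβα
        exact absurd (by rw [← hσ2 α, hβ.2, hβ.2]) hfix
      · simpa using h.2
  have hcomm : w * σ = σ * w := by
    rw [inv_mul_eq_one] at hone
    exact eq_mul_inv_iff_mul_eq.1 hone
  exact fun x => congrArg (· x) hcomm
end
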